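/- Normalization limit for the Weyl sequence: let ω ∈ ℝ, let φ : ℕ → ℂ solve the eigenvalue recurrence for ω and have plane-wave asymptotics with amplitude A, and let g : ℝ → ℝ be a Schwartz function. Then lim_{k→∞} (1/k)·Σ_{n=1}^∞ g(χ(n/2)/k)²·|φ n|² = 4·|A|²·∫₀^∞ g(y)² dy. -/

import Mathlib

open MeasureTheory

/-- ξ(y) = √(y² + 1/16). -/
noncomputable def xi (y : ℝ) : ℝ := Real.sqrt (y ^ 2 + 1 / 16)

/-- χ(x) = log(2·√(4x² + 4x + 1) + √(16x² + 16x + 5)). -/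
noncomputable def chi (x : ℝ) : ℝ :=
  Real.log (2 * Real.sqrt (4 * x ^ 2 + 4 * x + 1) + Real.sqrt (16 * x ^ 2 + 16 * x + 5))

/-- f_s(x) = ξ(x+1/2)^(−1/2)·(A·exp(i·ω·χ(x)) − s·(conj A)·exp(−i·ω·χ(x))). -/
noncomputable def fpw (A : ℂ) (ω s x : ℝ) : ℂ :=
  ((xi (x + 1/2) ^ (-(1/2) : ℝ) : ℝ) : ℂ) *
    (A * Complex.exp (Complex.I * ω * chi x) -
      (s : ℂ) * (starRingEnd ℂ) A * Complex.exp (-(Complex.I * ω * chi x)))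

/-- φ : ℕ → ℂ solves the eigenvalue recurrence for ω (φ n is the coefficient at spin
j = n/2): φ 0 = 0 and ω·φ n = i·(n/2 + 3/4)·φ(n+1) − i·(n/2 + 1/4)·φ(n−1) for n ≥ 1. -/
def SolvesRec (ω : ℝ) (φ : ℕ → ℂ) : Prop :=
  φ 0 = 0 ∧ ∀ n : ℕ, 1 ≤ n →
    (ω : ℂ) * φ n =
      Complex.I * ((n : ℂ) / 2 + 3 / 4) * φ (n + 1) -
        Complex.I * ((n : ℂ) / 2 + 1 / 4) * φ (n - 1)

/-- φ has plane-wave asymptotics with amplitude A: there exist C > 0, Δ > 1 and N₀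
such that |φ n − f_{(−1)^n}(n/2)| ≤ C·(n/2)^(−Δ) for all n ≥ N₀. -/
def PlaneWaveAsymp (A : ℂ) (ω : ℝ) (φ : ℕ → ℂ) : Prop :=
  ∃ C : ℝ, 0 < C ∧ ∃ Δ : ℝ, 1 < Δ ∧ ∃ N₀ : ℕ, ∀ n : ℕ, N₀ ≤ n →
    ‖φ n - fpw A ω ((-1 : ℝ) ^ n) ((n : ℝ) / 2)‖ ≤ C * ((n : ℝ) / 2) ^ (-Δ)


open Filter Topology

/-- Riemann sums of a Lipschitz integrable function over a mesh whose steps are square summable. -/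
lemma riemann_sum_of_summable_sq {X : ℕ → ℝ} (hX : Monotone X) (hXtop : Tendsto X atTop atTop)
    (hsq : Summable fun n => (X (n + 1) - X n) ^ 2) {F : ℝ → ℝ} {L : ℝ}
    (hF : ∀ x y, |F x - F y| ≤ L * |x - y|) (hint : Integrable F) :
    Summable (fun n => F (X n) * (X (n + 1) - X n)) ∧
      |∑' n, F (X n) * (X (n + 1) - X n) - ∫ y in Set.Ioi (X 0), F y| ≤
        L * ∑' n, (X (n + 1) - X n) ^ 2 := by
  have hL : 0 ≤ L := by simpa using (abs_nonneg _).trans (hF 1 0)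
  set I : ℕ → ℝ := fun n => ∫ y in X n..X (n + 1), F y with hI
  have hstep : ∀ n, |F (X n) * (X (n + 1) - X n) - I n| ≤ L * (X (n + 1) - X n) ^ 2 := by
    intro n
    have hd : 0 ≤ X (n + 1) - X n := sub_nonneg.2 (hX n.le_succ)
    have h1 : I n - F (X n) * (X (n + 1) - X n) = ∫ y in X n..X (n + 1), (F y - F (X n)) := by
      rw [intervalIntegral.integral_sub hint.intervalIntegrable intervalIntegrable_const]
      simp [hI, mul_comm]
    have h2 : ‖∫ y in X n..X (n + 1), (F y - F (X n))‖ ≤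
        L * (X (n + 1) - X n) * |X (n + 1) - X n| := by
      refine intervalIntegral.norm_integral_le_of_norm_le_const fun y hy => ?_
      rw [Set.uIoc_of_le (hX n.le_succ)] at hy
      refine (hF _ _).trans (mul_le_mul_of_nonneg_left ?_ hL)
      rw [abs_of_nonneg (by linarith [hy.1])]
      linarith [hy.2]
    rw [abs_sub_comm, h1]
    rw [Real.norm_eq_abs, abs_of_nonneg hd] at h2
    linarith
  have hIsum : Summable I := by
    refine Summable.of_norm (summable_of_sum_range_le (c := ∫ y, ‖F y‖)
      (fun _ => norm_nonneg _) fun N => ?_)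
    calc ∑ n ∈ Finset.range N, ‖I n‖
        ≤ ∑ n ∈ Finset.range N, ∫ y in X n..X (n + 1), ‖F y‖ :=
          Finset.sum_le_sum fun n _ =>
            intervalIntegral.norm_integral_le_integral_norm (hX n.le_succ)
      _ = ∫ y in X 0..X N, ‖F y‖ :=
          intervalIntegral.sum_integral_adjacent_intervals
            fun n _ => hint.norm.intervalIntegrable
      _ = ∫ y in Set.Ioc (X 0) (X N), ‖F y‖ :=
          intervalIntegral.integral_of_le (hX N.zero_le)
      _ ≤ ∫ y, ‖F y‖ :=
          setIntegral_le_integral hint.norm (Eventually.of_forall fun _ => norm_nonneg _)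
  have hItsum : ∑' n, I n = ∫ y in Set.Ioi (X 0), F y := by
    refine tendsto_nhds_unique hIsum.hasSum.tendsto_sum_nat ?_
    have := intervalIntegral_tendsto_integral_Ioi (X 0) hint.integrableOn hXtop
    refine this.congr fun N => ?_
    rw [intervalIntegral.sum_integral_adjacent_intervals fun n _ => hint.intervalIntegrable]
  have hdiff : Summable fun n => F (X n) * (X (n + 1) - X n) - I n :=
    Summable.of_norm_bounded (hsq.mul_left L) hstep
  have hS : Summable fun n => F (X n) * (X (n + 1) - X n) := by
    simpa using hdiff.add hIsum
  refine ⟨hS, ?_⟩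
  rw [← hItsum, ← hS.tsum_sub hIsum, ← tsum_mul_left]
  exact tsum_of_norm_bounded (f := fun n => F (X n) * (X (n + 1) - X n) - I n)
    (hsq.mul_left L).hasSum hstep

/-- An absolutely convergent alternating series is bounded by the total variation of its terms. -/
lemma abs_tsum_alternating_le {b v : ℕ → ℝ} (hb : Summable b) (hv : Summable v)
    (h : ∀ n, |b (n + 1) - b n| ≤ v n) :
    |∑' n, (-1 : ℝ) ^ n * b n| ≤ |b 0| + ∑' n, v n := by
  have hs : Summable fun n => (-1 : ℝ) ^ n * b n :=
    Summable.of_norm_bounded hb.abs fun n => by simp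
  have hs' : Summable fun n => (-1 : ℝ) ^ (n + 1) * b (n + 1) := (summable_nat_add_iff 1).2 hs
  have h1 : ∑' n, (-1 : ℝ) ^ n * b n = b 0 + ∑' n, (-1 : ℝ) ^ (n + 1) * b (n + 1) := by
    rw [hs.tsum_eq_zero_add]; simp
  have h2 : 2 * ∑' n, (-1 : ℝ) ^ n * b n =
      b 0 + ∑' n, ((-1 : ℝ) ^ (n + 1) * b (n + 1) + (-1 : ℝ) ^ n * b n) := by
    rw [hs'.tsum_add hs]; linarith
  have h3 : |∑' n, ((-1 : ℝ) ^ (n + 1) * b (n + 1) + (-1 : ℝ) ^ n * b n)| ≤ ∑' n, v n := by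
    rw [← Real.norm_eq_abs]
    refine tsum_of_norm_bounded hv.hasSum fun n => ?_
    have : (-1 : ℝ) ^ (n + 1) * b (n + 1) + (-1 : ℝ) ^ n * b n =
        (-1 : ℝ) ^ n * -(b (n + 1) - b n) := by ring
    rw [this, norm_mul, norm_neg]
    simpa using h n
  have h4 := abs_add_le (b 0) (∑' n, ((-1 : ℝ) ^ (n + 1) * b (n + 1) + (-1 : ℝ) ^ n * b n))
  rw [← h2, abs_mul, abs_two] at h4
  linarith [abs_nonneg (∑' n, (-1 : ℝ) ^ n * b n)]

/-- The value of `χ` at `n / 2`. -/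
noncomputable def chiHalf (n : ℕ) : ℝ := Real.arsinh (2 * n + 2)

/-- Half of the derivative of `n ↦ χ (n / 2)`. -/
noncomputable def chiSlope (n : ℕ) : ℝ := (√(1 + (2 * (n : ℝ) + 2) ^ 2))⁻¹

lemma chi_half (n : ℕ) : chi ((n : ℝ) / 2) = chiHalf n := by
  have h : (0 : ℝ) ≤ 2 * ((n : ℝ) / 2) + 1 := by positivity
  have h1 : √(4 * ((n : ℝ) / 2) ^ 2 + 4 * ((n : ℝ) / 2) + 1) = 2 * ((n : ℝ) / 2) + 1 := by
    rw [← Real.sqrt_sq h]; congr 1; ring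
  rw [chi, chiHalf, Real.arsinh, h1]
  congr 2
  · ring
  · congr 1; ring

lemma xi_half (n : ℕ) : (xi ((n : ℝ) / 2 + 1 / 2))⁻¹ = 4 * chiSlope n := by
  have h : xi ((n : ℝ) / 2 + 1 / 2) = √(1 + (2 * (n : ℝ) + 2) ^ 2) / 4 := by
    rw [xi, Real.sqrt_eq_iff_mul_self_eq (by positivity) (by positivity),
      div_mul_div_comm, Real.mul_self_sqrt (by positivity)]
    ring
  rw [h, chiSlope, inv_div, div_eq_mul_inv]

lemma chiSlope_pos (n : ℕ) : 0 < chiSlope n := by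
  unfold chiSlope; positivity

lemma chiSlope_le (n : ℕ) : chiSlope n ≤ 1 / ((n : ℝ) + 1) := by
  rw [chiSlope, ← one_div]
  refine one_div_le_one_div_of_le (by positivity) (Real.le_sqrt_of_sq_le ?_)
  nlinarith [(n.cast_nonneg : (0 : ℝ) ≤ n)]

lemma chiSlope_le_one (n : ℕ) : chiSlope n ≤ 1 :=
  (chiSlope_le n).trans (by
    rw [div_le_one (by positivity)]; linarith [(n.cast_nonneg : (0 : ℝ) ≤ n)])

lemma summable_chiSlope_sq : Summable fun n => chiSlope n ^ 2 := by
  have h : Summable fun n : ℕ => 1 / ((n : ℝ) + 1) ^ 2 := by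
    simpa using (summable_nat_add_iff 1).2 (Real.summable_one_div_nat_pow.2 one_lt_two)
  refine h.of_nonneg_of_le (fun _ => sq_nonneg _) fun n => ?_
  rw [← one_div_pow]
  exact pow_le_pow_left₀ (chiSlope_pos n).le (chiSlope_le n) 2

lemma chiSlope_succ_le (n : ℕ) : chiSlope (n + 1) ≤ chiSlope n := by
  unfold chiSlope
  gcongr
  simp

lemma chiSlope_sub_succ_le (n : ℕ) : chiSlope n - chiSlope (n + 1) ≤ 2 * chiSlope n ^ 2 := by
  have hlip : √(1 + (2 * ((n + 1 : ℕ) : ℝ) + 2) ^ 2) ≤ √(1 + (2 * (n : ℝ) + 2) ^ 2) + 2 := by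
    have h1 : 2 * (n : ℝ) + 2 ≤ √(1 + (2 * (n : ℝ) + 2) ^ 2) :=
      Real.le_sqrt_of_sq_le (by linarith)
    rw [Real.sqrt_le_left (by positivity)]
    have h2 := Real.sq_sqrt (show (0 : ℝ) ≤ 1 + (2 * (n : ℝ) + 2) ^ 2 by positivity)
    push_cast
    nlinarith
  have ha := chiSlope_pos n
  have hb := chiSlope_pos (n + 1)
  have hle := chiSlope_succ_le n
  have h3 : chiSlope n - chiSlope (n + 1) =
      ((chiSlope (n + 1))⁻¹ - (chiSlope n)⁻¹) * (chiSlope n * chiSlope (n + 1)) := by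
    field_simp
  have h4 : (chiSlope (n + 1))⁻¹ - (chiSlope n)⁻¹ ≤ 2 := by
    simp only [chiSlope, inv_inv]; linarith
  rw [h3]
  calc _ ≤ 2 * (chiSlope n * chiSlope (n + 1)) := by gcongr
    _ ≤ 2 * chiSlope n ^ 2 := by rw [sq]; gcongr

lemma chiHalf_step_bounds (n : ℕ) :
    2 * chiSlope (n + 1) ≤ chiHalf (n + 1) - chiHalf n ∧
      chiHalf (n + 1) - chiHalf n ≤ 2 * chiSlope n := by
  have hn : (0 : ℝ) ≤ n := n.cast_nonneg
  obtain ⟨c, ⟨hc1, hc2⟩, hc⟩ := exists_hasDerivAt_eq_slope Real.arsinh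
    (fun x => (√(1 + x ^ 2))⁻¹) (a := 2 * n + 2) (b := 2 * (n + 1 : ℕ) + 2)
    (by push_cast; linarith) Real.continuous_arsinh.continuousOn
    fun x _ => Real.hasDerivAt_arsinh x
  have h1 : chiHalf (n + 1) - chiHalf n = 2 * (√(1 + c ^ 2))⁻¹ := by
    rw [hc, chiHalf, chiHalf]; push_cast; ring
  rw [h1, chiSlope, chiSlope]
  constructor <;> gcongr
  linarith

lemma monotone_chiHalf : Monotone chiHalf :=
  monotone_nat_of_le_succ fun n => by
    linarith [(chiHalf_step_bounds n).1, chiSlope_pos (n + 1)]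

lemma tendsto_chiHalf : Tendsto chiHalf atTop atTop := by
  have h : Tendsto Real.arsinh atTop atTop := Real.sinhOrderIso.symm.tendsto_atTop
  refine h.comp (tendsto_atTop_mono (fun n => ?_) tendsto_natCast_atTop_atTop)
  linarith [(n.cast_nonneg : (0 : ℝ) ≤ n)]

lemma chiHalf_zero_nonneg : 0 ≤ chiHalf 0 := by
  simp [chiHalf]

lemma summable_chiHalf_step_sq : Summable fun n => (chiHalf (n + 1) - chiHalf n) ^ 2 := by
  refine (summable_chiSlope_sq.mul_left 4).of_nonneg_of_le (fun _ => sq_nonneg _) fun n => ?_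
  have h := chiHalf_step_bounds n
  have := chiSlope_pos (n + 1)
  nlinarith

/-- The product of bounded Lipschitz functions is Lipschitz. -/
lemma abs_mul_sub_mul_le {F E : ℝ → ℝ} {M L N K : ℝ} (hFM : ∀ x, |F x| ≤ M)
    (hFL : ∀ x y, |F x - F y| ≤ L * |x - y|) (hEN : ∀ x, |E x| ≤ N)
    (hEK : ∀ x y, |E x - E y| ≤ K * |x - y|) (x y : ℝ) :
    |F x * E x - F y * E y| ≤ (M * K + L * N) * |x - y| := by
  have h : F x * E x - F y * E y = F x * (E x - E y) + (F x - F y) * E y := by ring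
  have hM : 0 ≤ M := (abs_nonneg _).trans (hFM 0)
  have hL : 0 ≤ L * |x - y| := (abs_nonneg _).trans (hFL x y)
  rw [h]
  refine (abs_add_le _ _).trans ?_
  rw [abs_mul, abs_mul]
  have h1 := mul_le_mul (hFM x) (hEK x y) (abs_nonneg _) hM
  have h2 := mul_le_mul (hFL x y) (hEN y) (abs_nonneg _) hL
  linarith

lemma abs_two_mul_chiSlope_sub_le (n : ℕ) :
    |2 * chiSlope n - (chiHalf (n + 1) - chiHalf n)| ≤ 4 * chiSlope n ^ 2 := by
  obtain ⟨h1, h2⟩ := chiHalf_step_bounds n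
  rw [abs_of_nonneg (by linarith)]
  linarith [chiSlope_sub_succ_le n]

lemma summable_and_abs_tsum_mul_chiSlope_sub_le {F : ℝ → ℝ} {M L : ℝ} (hM : ∀ x, |F x| ≤ M)
    (hL : ∀ x y, |F x - F y| ≤ L * |x - y|) (hint : Integrable F) :
    Summable (fun n => F (chiHalf n) * chiSlope n) ∧
      |2 * ∑' n, F (chiHalf n) * chiSlope n - ∫ y in Set.Ioi (0 : ℝ), F y| ≤
        L * ∑' n, (chiHalf (n + 1) - chiHalf n) ^ 2 + 4 * M * ∑' n, chiSlope n ^ 2 +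
          M * chiHalf 0 := by
  have hM0 : 0 ≤ M := (abs_nonneg _).trans (hM 0)
  obtain ⟨hs, hR⟩ := riemann_sum_of_summable_sq monotone_chiHalf tendsto_chiHalf
    summable_chiHalf_step_sq hL hint
  have hbd : ∀ n, ‖F (chiHalf n) * (2 * chiSlope n - (chiHalf (n + 1) - chiHalf n))‖ ≤
      4 * M * chiSlope n ^ 2 := fun n => by
    rw [Real.norm_eq_abs, abs_mul]
    have := mul_le_mul (hM (chiHalf n)) (abs_two_mul_chiSlope_sub_le n) (abs_nonneg _) hM0
    linarith
  have hsq := summable_chiSlope_sq.mul_left (4 * M)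
  have hd := Summable.of_norm_bounded hsq hbd
  have hdle := tsum_of_norm_bounded hsq.hasSum hbd
  rw [tsum_mul_left, Real.norm_eq_abs] at hdle
  have hsum : Summable fun n => F (chiHalf n) * chiSlope n :=
    ((hs.add hd).mul_left (1 / 2)).congr fun n => by ring
  refine ⟨hsum, ?_⟩
  have h1 : 2 * ∑' n, F (chiHalf n) * chiSlope n =
      ∑' n, F (chiHalf n) * (chiHalf (n + 1) - chiHalf n) +
        ∑' n, F (chiHalf n) * (2 * chiSlope n - (chiHalf (n + 1) - chiHalf n)) := by
    rw [← tsum_mul_left, ← hs.tsum_add hd]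
    exact tsum_congr fun n => by ring
  have h2 := intervalIntegral.integral_Ioi_sub_Ioi (μ := volume) (f := F)
    hint.integrableOn chiHalf_zero_nonneg
  have h3 : |∫ y in (0 : ℝ)..chiHalf 0, F y| ≤ M * |chiHalf 0 - 0| := by
    rw [← Real.norm_eq_abs]
    exact intervalIntegral.norm_integral_le_of_norm_le_const fun y _ => hM y
  rw [sub_zero, abs_of_nonneg chiHalf_zero_nonneg] at h3
  rw [abs_le] at hR hdle h3 ⊢
  constructor <;> linarith [hR.1, hR.2, hdle.1, hdle.2, h3.1, h3.2]

lemma abs_tsum_alternating_mul_chiSlope_le {E : ℝ → ℝ} {M L : ℝ} (hM : ∀ x, |E x| ≤ M)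
    (hL : ∀ x y, |E x - E y| ≤ L * |x - y|)
    (hs : Summable fun n => E (chiHalf n) * chiSlope n) :
    |∑' n, (-1 : ℝ) ^ n * (E (chiHalf n) * chiSlope n)| ≤
      M + (2 * L + 2 * M) * ∑' n, chiSlope n ^ 2 := by
  have hM0 : 0 ≤ M := (abs_nonneg _).trans (hM 0)
  have hL0 : 0 ≤ L := by simpa using (abs_nonneg _).trans (hL 1 0)
  rw [← tsum_mul_left]
  have h0 : |E (chiHalf 0) * chiSlope 0| ≤ M := by
    rw [abs_mul, abs_of_pos (chiSlope_pos 0)]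
    exact (mul_le_of_le_one_right (abs_nonneg _) (chiSlope_le_one 0)).trans (hM _)
  refine (abs_tsum_alternating_le hs (summable_chiSlope_sq.mul_left (2 * L + 2 * M))
    fun n => ?_).trans (by gcongr)
  have hp := chiSlope_pos n
  obtain ⟨hd1, hd2⟩ := chiHalf_step_bounds n
  have hd0 : 0 ≤ chiHalf (n + 1) - chiHalf n := by linarith [chiSlope_pos (n + 1)]
  have e : E (chiHalf (n + 1)) * chiSlope (n + 1) - E (chiHalf n) * chiSlope n =
      (E (chiHalf (n + 1)) - E (chiHalf n)) * chiSlope n +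
        E (chiHalf (n + 1)) * (chiSlope (n + 1) - chiSlope n) := by ring
  have h1 : |(E (chiHalf (n + 1)) - E (chiHalf n)) * chiSlope n| ≤
      L * (2 * chiSlope n) * chiSlope n := by
    rw [abs_mul, abs_of_pos hp]
    have := hL (chiHalf (n + 1)) (chiHalf n)
    rw [abs_of_nonneg hd0] at this
    gcongr
    exact this.trans (by gcongr)
  have h2 : |E (chiHalf (n + 1)) * (chiSlope (n + 1) - chiSlope n)| ≤
      M * (2 * chiSlope n ^ 2) := by
    rw [abs_mul, abs_sub_comm, abs_of_nonneg (sub_nonneg.2 (chiSlope_succ_le n))]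
    exact mul_le_mul (hM _) (chiSlope_sub_succ_le n)
      (sub_nonneg.2 (chiSlope_succ_le n)) hM0
  rw [e]
  exact (abs_add_le _ _).trans (by linarith)

/-- Weighted sums along `χ (n / 2)` are controlled uniformly over bounded Lipschitz profiles. -/
lemma exists_abs_tsum_sub_integral_le {ρ : ℝ → ℝ} {N K B : ℝ} (hN : ∀ x, |ρ x| ≤ N)
    (hK : ∀ x y, |ρ x - ρ y| ≤ K * |x - y|) {w : ℕ → ℝ}
    (hw : Summable fun n =>
      w n - 8 * chiSlope n * (B - (-1) ^ n * ρ (chiHalf n))) (M L : ℝ) :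
    ∃ C : ℝ, ∀ F : ℝ → ℝ, (∀ x, |F x| ≤ M) → (∀ x y, |F x - F y| ≤ L * |x - y|) →
      Integrable F →
      |∑' n, F (chiHalf n) * w n - 4 * B * ∫ y in Set.Ioi (0 : ℝ), F y| ≤ C := by
  set r : ℕ → ℝ := fun n => w n - 8 * chiSlope n * (B - (-1) ^ n * ρ (chiHalf n)) with hr
  set C₁ := L * ∑' n, (chiHalf (n + 1) - chiHalf n) ^ 2 + 4 * M * ∑' n, chiSlope n ^ 2 +
    M * chiHalf 0 with hC₁
  set C₂ := M * N + (2 * (M * K + L * N) + 2 * (M * N)) * ∑' n, chiSlope n ^ 2 with hC₂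
  refine ⟨4 * |B| * C₁ + 8 * C₂ + M * ∑' n, |r n|, fun F hM hL hint => ?_⟩
  have hM0 : 0 ≤ M := (abs_nonneg _).trans (hM 0)
  obtain ⟨hs, h1⟩ := summable_and_abs_tsum_mul_chiSlope_sub_le hM hL hint
  have hEs : Summable fun n => F (chiHalf n) * ρ (chiHalf n) * chiSlope n := by
    refine Summable.of_norm_bounded (hs.abs.mul_left N) fun n => ?_
    rw [mul_right_comm, norm_mul, mul_comm]
    exact mul_le_mul_of_nonneg_right (hN _) (abs_nonneg _)
  have h2 := abs_tsum_alternating_mul_chiSlope_le (E := fun x => F x * ρ x) (M := M * N)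
    (fun x => by rw [abs_mul]; exact mul_le_mul (hM x) (hN x) (abs_nonneg _) hM0)
    (abs_mul_sub_mul_le hM hL hN hK) hEs
  have hEs' : Summable fun n => (-1 : ℝ) ^ n * (F (chiHalf n) * ρ (chiHalf n) * chiSlope n) :=
    Summable.of_norm_bounded hEs.abs fun n => by simp
  have hbd : ∀ n, ‖F (chiHalf n) * r n‖ ≤ M * |r n| := fun n => by
    rw [norm_mul]; exact mul_le_mul_of_nonneg_right (hM _) (abs_nonneg _)
  have hrs := Summable.of_norm_bounded (hw.abs.mul_left M) hbd
  have h3 := tsum_of_norm_bounded (hw.abs.mul_left M).hasSum hbd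
  rw [tsum_mul_left, Real.norm_eq_abs] at h3
  have e : ∑' n, F (chiHalf n) * w n = 8 * B * ∑' n, F (chiHalf n) * chiSlope n -
      8 * ∑' n, (-1 : ℝ) ^ n * (F (chiHalf n) * ρ (chiHalf n) * chiSlope n) +
        ∑' n, F (chiHalf n) * r n := by
    rw [← tsum_mul_left, ← tsum_mul_left,
      ← (hs.mul_left (8 * B)).tsum_sub (hEs'.mul_left 8),
      ← ((hs.mul_left (8 * B)).sub (hEs'.mul_left 8)).tsum_add hrs]
    exact tsum_congr fun n => by simp only [hr]; ring
  have e' : ∑' n, F (chiHalf n) * w n - 4 * B * ∫ y in Set.Ioi (0 : ℝ), F y =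
      4 * B * (2 * ∑' n, F (chiHalf n) * chiSlope n - ∫ y in Set.Ioi (0 : ℝ), F y) +
      (-8) * ∑' n, (-1 : ℝ) ^ n * (F (chiHalf n) * ρ (chiHalf n) * chiSlope n) +
        ∑' n, F (chiHalf n) * r n := by
    rw [e]; ring
  rw [e']
  refine (abs_add_three _ _ _).trans ?_
  rw [abs_mul, abs_mul, abs_mul]
  have h8 : |(-8 : ℝ)| = 8 := by norm_num
  have h4 : |(4 : ℝ)| = 4 := by norm_num
  rw [h8, h4]
  gcongr

/-- The real part of `A² exp (2iωt)`. -/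
noncomputable def interference (A : ℂ) (ω t : ℝ) : ℝ :=
  (A ^ 2).re * Real.cos (2 * ω * t) - (A ^ 2).im * Real.sin (2 * ω * t)

lemma abs_interference_le (A : ℂ) (ω t : ℝ) :
    |interference A ω t| ≤ |(A ^ 2).re| + |(A ^ 2).im| := by
  refine (abs_sub _ _).trans ?_
  rw [abs_mul, abs_mul]
  exact add_le_add (mul_le_of_le_one_right (abs_nonneg _) (Real.abs_cos_le_one _))
    (mul_le_of_le_one_right (abs_nonneg _) (Real.abs_sin_le_one _))

lemma abs_interference_sub_le (A : ℂ) (ω x y : ℝ) :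
    |interference A ω x - interference A ω y| ≤
      ((|(A ^ 2).re| + |(A ^ 2).im|) * |2 * ω|) * |x - y| := by
  have e : interference A ω x - interference A ω y =
      (A ^ 2).re * (Real.cos (2 * ω * x) - Real.cos (2 * ω * y)) -
        (A ^ 2).im * (Real.sin (2 * ω * x) - Real.sin (2 * ω * y)) := by
    unfold interference; ring
  have h : |2 * ω * x - 2 * ω * y| = |2 * ω| * |x - y| := by rw [← mul_sub, abs_mul]
  rw [e, mul_assoc (|(A ^ 2).re| + |(A ^ 2).im|), add_mul, ← h]
  refine (abs_sub _ _).trans ?_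
  rw [abs_mul, abs_mul]
  exact add_le_add
    (mul_le_mul_of_nonneg_left (Real.abs_cos_sub_cos_le _ _) (abs_nonneg _))
    (mul_le_mul_of_nonneg_left (Real.abs_sin_sub_sin_le _ _) (abs_nonneg _))

lemma norm_sq_fpw_half (A : ℂ) (ω : ℝ) (n : ℕ) :
    ‖fpw A ω ((-1 : ℝ) ^ n) ((n : ℝ) / 2)‖ ^ 2 =
      8 * chiSlope n * (‖A‖ ^ 2 - (-1) ^ n * interference A ω (chiHalf n)) := by
  have hs : ((-1 : ℝ) ^ n) ^ 2 = 1 := by rw [← pow_mul, mul_comm, pow_mul]; simp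
  set s : ℝ := (-1 : ℝ) ^ n
  have hxi : 0 ≤ xi ((n : ℝ) / 2 + 1 / 2) := Real.sqrt_nonneg _
  have hamp : (xi ((n : ℝ) / 2 + 1 / 2) ^ (-(1 / 2) : ℝ)) ^ 2 = 4 * chiSlope n := by
    rw [← Real.rpow_natCast, ← Real.rpow_mul hxi, ← xi_half, ← Real.rpow_neg_one]
    norm_num
  set θ : ℝ := ω * chiHalf n with hθ
  have hexp : Complex.exp (Complex.I * ω * chi ((n : ℝ) / 2)) =
      ⟨Real.cos θ, Real.sin θ⟩ := by
    rw [chi_half, show Complex.I * ω * (chiHalf n : ℂ) = (θ : ℂ) * Complex.I by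
      rw [hθ]; push_cast; ring]
    apply Complex.ext <;> simp [Complex.exp_ofReal_mul_I_re, Complex.exp_ofReal_mul_I_im]
  have hexp' : Complex.exp (-(Complex.I * ω * chi ((n : ℝ) / 2))) =
      ⟨Real.cos θ, -Real.sin θ⟩ := by
    rw [chi_half, show -(Complex.I * ω * (chiHalf n : ℂ)) = ((-θ : ℝ) : ℂ) * Complex.I by
      rw [hθ]; push_cast; ring]
    apply Complex.ext
    · rw [Complex.exp_ofReal_mul_I_re, Real.cos_neg]
    · rw [Complex.exp_ofReal_mul_I_im, Real.sin_neg]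
  rw [fpw, norm_mul, mul_pow, Complex.norm_real, Real.norm_eq_abs, sq_abs, hamp, hexp, hexp',
    Complex.sq_norm, Complex.sq_norm, interference,
    show 2 * ω * chiHalf n = 2 * θ by rw [hθ]; ring, Real.cos_two_mul, Real.sin_two_mul]
  have hcs := Real.sin_sq_add_cos_sq θ
  simp only [Complex.normSq_apply, Complex.sub_re, Complex.sub_im, Complex.mul_re,
    Complex.mul_im, Complex.ofReal_re, Complex.ofReal_im, Complex.conj_re, Complex.conj_im, sq]
  set c := Real.cos θ
  set d := Real.sin θ
  have hd : d ^ 2 = 1 - c ^ 2 := by linarith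
  ring_nf
  simp only [hd, hs]
  ring

lemma summable_norm_sq_sub_of_planeWaveAsymp {A : ℂ} {ω : ℝ} {φ : ℕ → ℂ}
    (h : PlaneWaveAsymp A ω φ) :
    Summable fun n => ‖φ n‖ ^ 2 -
      8 * chiSlope n * (‖A‖ ^ 2 - (-1) ^ n * interference A ω (chiHalf n)) := by
  obtain ⟨C, hC, Δ, hΔ, N₀, hN⟩ := h
  set N := |(A ^ 2).re| + |(A ^ 2).im|
  set D := √(8 * (‖A‖ ^ 2 + N)) with hD
  have hsum : Summable fun n : ℕ => C * ((n : ℝ) / 2) ^ (-Δ) := by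
    refine Summable.mul_left C ?_
    refine ((Real.summable_nat_rpow.2 (show -Δ < -1 by linarith)).div_const
      ((2 : ℝ) ^ (-Δ))).congr fun n => ?_
    rw [Real.div_rpow (by positivity) (by positivity)]
  have hfD : ∀ n : ℕ, ‖fpw A ω ((-1 : ℝ) ^ n) ((n : ℝ) / 2)‖ ≤ D := fun n => by
    refine Real.le_sqrt_of_sq_le ?_
    rw [norm_sq_fpw_half]
    have h1 : ‖A‖ ^ 2 - (-1) ^ n * interference A ω (chiHalf n) ≤ ‖A‖ ^ 2 + N := by
      have h2 : |(-1) ^ n * interference A ω (chiHalf n)| ≤ N := by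
        simpa [abs_mul] using abs_interference_le A ω (chiHalf n)
      linarith [(abs_le.1 h2).1]
    have h3 : 0 ≤ ‖A‖ ^ 2 + N := by positivity
    calc _ ≤ 8 * chiSlope n * (‖A‖ ^ 2 + N) := by
          have := chiSlope_pos n
          gcongr
      _ ≤ 8 * 1 * (‖A‖ ^ 2 + N) := by
          have := chiSlope_le_one n
          gcongr
      _ = _ := by ring
  have hsmall : ∀ᶠ n : ℕ in atTop, C * ((n : ℝ) / 2) ^ (-Δ) ≤ 1 :=
    hsum.tendsto_atTop_zero.eventually_le_const one_pos
  refine Summable.of_norm_bounded_eventually_nat (hsum.mul_right (2 * D + 1)) ?_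
  filter_upwards [hsmall, eventually_ge_atTop N₀] with n hn1 hn2
  rw [← norm_sq_fpw_half]
  have hb := hN n hn2
  set f := fpw A ω ((-1 : ℝ) ^ n) ((n : ℝ) / 2)
  have h1 : |‖φ n‖ - ‖f‖| ≤ C * ((n : ℝ) / 2) ^ (-Δ) := (abs_norm_sub_norm_le _ _).trans hb
  have h2 : ‖φ n‖ + ‖f‖ ≤ 2 * D + 1 := by linarith [(abs_le.1 h1).2, hfD n]
  rw [show ‖φ n‖ ^ 2 - ‖f‖ ^ 2 = (‖φ n‖ - ‖f‖) * (‖φ n‖ + ‖f‖) by ring, norm_mul,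
    Real.norm_eq_abs, Real.norm_eq_abs, abs_of_nonneg (a := ‖φ n‖ + ‖f‖) (by positivity)]
  exact mul_le_mul h1 h2 (by positivity) ((abs_nonneg _).trans h1)

lemma SchwartzMap.exists_abs_sub_le (g : SchwartzMap ℝ ℝ) :
    ∃ L : ℝ, ∀ x y, |g x - g y| ≤ L * |x - y| := by
  refine ⟨SchwartzMap.seminorm ℝ 0 0 (SchwartzMap.derivCLM ℝ ℝ g), fun x y => ?_⟩
  refine Convex.norm_image_sub_le_of_norm_deriv_le (fun z _ => g.differentiableAt)
    (fun z _ => ?_) convex_univ (Set.mem_univ y) (Set.mem_univ x)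
  exact SchwartzMap.norm_le_seminorm ℝ (SchwartzMap.derivCLM ℝ ℝ g) z

/-- Normalization limit for the Weyl sequence: if φ solves the eigenvalue recurrence
for ω and has plane-wave asymptotics with amplitude A, then for every Schwartz
function g, (1/k)·Σ_{n≥1} g(χ(n/2)/k)²·|φ n|² → 4·|A|²·∫₀^∞ g(y)² dy as k → ∞. -/
theorem weyl_sequence_normalization (ω : ℝ) (A : ℂ) (φ : ℕ → ℂ)
    (hrec : SolvesRec ω φ) (hasymp : PlaneWaveAsymp A ω φ) (g : SchwartzMap ℝ ℝ) :
    Filter.Tendsto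
      (fun k : ℕ => (1 / (k : ℝ)) *
        ∑' n : ℕ, (g (chi ((n : ℝ) / 2) / k)) ^ 2 * ‖φ n‖ ^ 2)
      Filter.atTop
      (nhds (4 * ‖A‖ ^ 2 * ∫ y in Set.Ioi (0 : ℝ), (g y) ^ 2)) := by
  obtain ⟨L, hgL⟩ := g.exists_abs_sub_le
  set M := SchwartzMap.seminorm ℝ 0 0 g
  have hgM : ∀ x, |g x| ≤ M := SchwartzMap.norm_le_seminorm ℝ g
  have hM0 : 0 ≤ M := (abs_nonneg _).trans (hgM 0)
  set G : ℝ → ℝ := fun y => g y ^ 2 with hG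
  have hGM : ∀ x, |G x| ≤ M ^ 2 := fun x => by
    rw [hG, abs_pow]; exact pow_le_pow_left₀ (abs_nonneg _) (hgM x) 2
  have hGL : ∀ x y, |G x - G y| ≤ (M * L + L * M) * |x - y| := fun x y => by
    simpa only [hG, sq] using abs_mul_sub_mul_le hgM hgL hgM hgL x y
  have hL0 : 0 ≤ M * L + L * M := by simpa using (abs_nonneg _).trans (hGL 1 0)
  have hGint : Integrable G := (g.memLp 2).integrable_sq
  obtain ⟨C, hC⟩ := exists_abs_tsum_sub_integral_le (abs_interference_le A ω)
    (abs_interference_sub_le A ω) (summable_norm_sq_sub_of_planeWaveAsymp hasymp)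
    (M ^ 2) (M * L + L * M)
  rw [tendsto_iff_norm_sub_tendsto_zero]
  refine squeeze_zero' (Eventually.of_forall fun _ => norm_nonneg _) ?_
    (tendsto_const_div_atTop_nhds_zero_nat C)
  filter_upwards [eventually_ge_atTop 1] with k hk
  have hk1 : (1 : ℝ) ≤ k := by exact_mod_cast hk
  have hk0 : (0 : ℝ) < k := by linarith
  have hbound := hC (fun y => G (y / k)) (fun x => hGM _)
    (fun x y => (hGL _ _).trans (mul_le_mul_of_nonneg_left (by
      rw [← sub_div, abs_div, abs_of_pos hk0]
      exact div_le_self (abs_nonneg _) hk1) hL0)) (hGint.comp_div hk0.ne')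
  have hscale : ∫ y in Set.Ioi (0 : ℝ), G (y / k) = k * ∫ y in Set.Ioi (0 : ℝ), G y := by
    have := integral_comp_mul_right_Ioi G 0 (inv_pos.2 hk0)
    simpa [div_eq_mul_inv] using this
  rw [hscale] at hbound
  simp only [chi_half]
  rw [Real.norm_eq_abs, le_div_iff₀ hk0]
  have habs (a : ℝ) : |a| * k = |a * k| := by rw [abs_mul, abs_of_pos hk0]
  rw [habs, sub_mul, mul_right_comm, one_div, inv_mul_cancel₀ hk0.ne', one_mul]
  rwa [mul_assoc _ _ (k : ℝ), mul_comm _ (k : ℝ)]
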